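/- arXiv:2306.13896 — 4 statements merged into one kernel-verified Lean document; each statement's English description precedes it below -/
import Mathlib

section
/- Let n ≥ 0, let a = (a_0,…,a_n) be positive integers and m = (m_0,…,m_n) integers with 0 ≤ m_j ≤ a_j−1. Then the real Lagrangian L_m = {z ∈ ℂ^{n+1} : z_0^{a_0}+⋯+z_n^{a_n} = 1 and e^{2πi m_j/a_j}·conj(z_j) = z_j for all j}, with the subspace topology, is homotopy equivalent to the join L_{m_0} * L_{m_1} * ⋯ * L_{m_n}, where L_{m_j} = {z ∈ ℂ : z^{a_j} = 1 and e^{2πi m_j/a_j}·conj(z) = z}. -/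
noncomputable section

open scoped Classical

/-- The reflection `R_m^a : ℂ → ℂ`, `z ↦ e^{2πim/a} ⬝ conj z`. -/
def refl1 (a m : ℕ) (z : ℂ) : ℂ :=
  Complex.exp (2 * (Real.pi : ℂ) * Complex.I * (m : ℂ) / (a : ℂ)) * (starRingEnd ℂ) z

/-- The zero-dimensional real locus `L_m ⊆ V(a) ⊆ ℂ`. -/
def L1 (a m : ℕ) : Set ℂ := {z | z ^ a = 1 ∧ refl1 a m z = z}

/-- The real Lagrangian `L_𝐦` inside the Milnor fiber `V(𝐚) ⊆ ℂ^{n+1}`. -/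
def LSet (n : ℕ) (a m : Fin (n + 1) → ℕ) : Set (Fin (n + 1) → ℂ) :=
  {z | ∑ j, z j ^ a j = 1 ∧ ∀ j, refl1 (a j) (m j) (z j) = z j}

/-- The carrier `{(x, t) ∈ Π X_i × [0,1]^ι : ∑ t_i = 1}` of the join. -/
def JoinCarrier {ι : Type} [Fintype ι] (X : ι → Type) [∀ i, TopologicalSpace (X i)] : Type :=
  {p : (∀ i, X i) × (ι → ℝ) // (∀ i, p.2 i ∈ Set.Icc (0 : ℝ) 1) ∧ ∑ i, p.2 i = 1}

instance {ι : Type} [Fintype ι] (X : ι → Type) [∀ i, TopologicalSpace (X i)] :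
    TopologicalSpace (JoinCarrier X) := by unfold JoinCarrier; infer_instance

/-- `(x,t) ∼ (x',t')` iff `t = t'` and `x_i = x'_i` whenever `t_i > 0`. -/
def joinRel {ι : Type} [Fintype ι] (X : ι → Type) [∀ i, TopologicalSpace (X i)]
    (p q : JoinCarrier X) : Prop :=
  p.1.2 = q.1.2 ∧ ∀ i, 0 < p.1.2 i → p.1.1 i = q.1.1 i

/-- The join of the family of spaces `X`, with the quotient topology. -/
def SpaceJoin {ι : Type} [Fintype ι] (X : ι → Type) [∀ i, TopologicalSpace (X i)] : Type :=
  Quot (joinRel X)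

instance {ι : Type} [Fintype ι] (X : ι → Type) [∀ i, TopologicalSpace (X i)] :
    TopologicalSpace (SpaceJoin X) := by unfold SpaceJoin; infer_instance

section FixedLine

variable {a m : ℕ} {z : ℂ}

lemma refl1_ofReal_mul (r : ℝ) (h : refl1 a m z = z) : refl1 a m (r * z) = r * z := by
  conv_rhs => rw [← h]
  simp only [refl1, map_mul, Complex.conj_ofReal]
  ring

lemma ofReal_re_pow_of_refl1_eq (ha : 0 < a) (h : refl1 a m z = z) :
    (((z ^ a).re : ℝ) : ℂ) = z ^ a := by
  have ha' : (a : ℂ) ≠ 0 := by exact_mod_cast ha.ne'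
  have key : (starRingEnd ℂ) (z ^ a) = z ^ a := by
    conv_rhs => rw [← h]
    rw [refl1, mul_pow, ← Complex.exp_nat_mul, map_pow]
    have : (a : ℂ) * (2 * (Real.pi : ℂ) * Complex.I * (m : ℂ) / (a : ℂ))
        = m * (2 * Real.pi * Complex.I) := by field_simp
    rw [this, Complex.exp_nat_mul_two_pi_mul_I, one_mul]
  exact Complex.conj_eq_iff_re.mp key

lemma eq_zero_of_re_pow_eq_zero (ha : 0 < a) (h : refl1 a m z = z) (h0 : (z ^ a).re = 0) :
    z = 0 := by
  have := ofReal_re_pow_of_refl1_eq ha h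
  rw [h0, Complex.ofReal_zero] at this
  exact (pow_eq_zero_iff ha.ne').mp this.symm

lemma ofReal_rpow_inv_natCast_pow {t : ℝ} (ht : 0 ≤ t) (ha : 0 < a) :
    (((t ^ (a : ℝ)⁻¹ : ℝ)) : ℂ) ^ a = t := by
  rw [← Complex.ofReal_pow, Real.rpow_inv_natCast_pow ht ha.ne']

lemma inv_rpow_mul_mem_L1 (ha : 0 < a) (h : refl1 a m z = z) (hpos : 0 < (z ^ a).re) :
    ((((z ^ a).re ^ (a : ℝ)⁻¹)⁻¹ : ℝ) : ℂ) * z ∈ L1 a m := by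
  refine ⟨?_, refl1_ofReal_mul _ h⟩
  have h0 : (((z ^ a).re : ℝ) : ℂ) ≠ 0 := by exact_mod_cast hpos.ne'
  rw [mul_pow, Complex.ofReal_inv, inv_pow, ofReal_rpow_inv_natCast_pow hpos.le ha,
    ← ofReal_re_pow_of_refl1_eq ha h, Complex.ofReal_re, inv_mul_cancel₀ h0]

lemma finite_L1 (ha : 0 < a) : (L1 a m).Finite := by
  refine (Polynomial.nthRoots a (1 : ℂ)).toFinset.finite_toSet.subset fun z hz => ?_
  simpa [Polynomial.mem_nthRoots ha] using hz.1

/-- Shrink a point of the fixed line by the factor `1 - s` if its `a`-th power is negative. -/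
def shrinkNeg (a : ℕ) (s : ℝ) (z : ℂ) : ℂ :=
  if 0 ≤ (z ^ a).re then z else ((1 - s : ℝ) : ℂ) * z

lemma shrinkNeg_of_nonneg (s : ℝ) (h : 0 ≤ (z ^ a).re) : shrinkNeg a s z = z := if_pos h

@[simp] lemma shrinkNeg_zero : shrinkNeg a 0 z = z := by simp [shrinkNeg]

lemma refl1_shrinkNeg (s : ℝ) (h : refl1 a m z = z) :
    refl1 a m (shrinkNeg a s z) = shrinkNeg a s z := by
  unfold shrinkNeg
  split_ifs
  exacts [h, refl1_ofReal_mul _ h]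

lemma re_pow_le_re_shrinkNeg_pow {s : ℝ} (hs : s ∈ unitInterval) :
    (z ^ a).re ≤ (shrinkNeg a s z ^ a).re := by
  unfold shrinkNeg
  split_ifs with h
  · rfl
  · rw [mul_pow, ← Complex.ofReal_pow, Complex.re_ofReal_mul]
    have h1 : (1 - s) ^ a ≤ 1 := pow_le_one₀ (by linarith [hs.2]) (by linarith [hs.1])
    nlinarith

lemma re_shrinkNeg_one_pow_nonneg (ha : 0 < a) : 0 ≤ (shrinkNeg a 1 z ^ a).re := by
  unfold shrinkNeg
  split_ifs with h
  · exact h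
  · simp [ha.ne']

end FixedLine

section Retraction

variable {n : ℕ} {a m : Fin (n + 1) → ℕ}

/-- Weighted rescaling of `w` onto the hypersurface `∑ j, z j ^ a j = 1`. -/
def weightedNormalize (a : Fin (n + 1) → ℕ) (w : Fin (n + 1) → ℂ) (j : Fin (n + 1)) : ℂ :=
  ((((∑ k, (w k ^ a k).re) ^ (a j : ℝ)⁻¹)⁻¹ : ℝ) : ℂ) * w j

lemma weightedNormalize_pow (ha : ∀ j, 0 < a j) {w : Fin (n + 1) → ℂ}
    (hpos : 0 < ∑ k, (w k ^ a k).re) (j : Fin (n + 1)) :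
    weightedNormalize a w j ^ a j = (((∑ k, (w k ^ a k).re)⁻¹ : ℝ) : ℂ) * w j ^ a j := by
  rw [weightedNormalize, mul_pow, Complex.ofReal_inv, inv_pow,
    ofReal_rpow_inv_natCast_pow hpos.le (ha j), Complex.ofReal_inv]

lemma weightedNormalize_mem (ha : ∀ j, 0 < a j) {w : Fin (n + 1) → ℂ}
    (hw : ∀ j, refl1 (a j) (m j) (w j) = w j) (hpos : 0 < ∑ k, (w k ^ a k).re) :
    weightedNormalize a w ∈ LSet n a m := by
  refine ⟨?_, fun j => refl1_ofReal_mul _ (hw j)⟩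
  have hsum : ∑ k, w k ^ a k = ((∑ k, (w k ^ a k).re : ℝ) : ℂ) := by
    rw [Complex.ofReal_sum]
    exact Finset.sum_congr rfl fun k _ => (ofReal_re_pow_of_refl1_eq (ha k) (hw k)).symm
  rw [Finset.sum_congr rfl fun j _ => weightedNormalize_pow ha hpos j, ← Finset.mul_sum, hsum,
    ← Complex.ofReal_mul, inv_mul_cancel₀ hpos.ne', Complex.ofReal_one]

lemma sum_re_pow_eq_one {z : Fin (n + 1) → ℂ} (hz : z ∈ LSet n a m) :
    ∑ k, (z k ^ a k).re = 1 := by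
  rw [← Complex.re_sum, hz.1, Complex.one_re]

lemma weightedNormalize_of_mem {z : Fin (n + 1) → ℂ} (hz : z ∈ LSet n a m) :
    weightedNormalize a z = z := by
  funext j
  simp [weightedNormalize, sum_re_pow_eq_one hz]

lemma one_le_sum_re_shrinkNeg_pow {z : Fin (n + 1) → ℂ} (hz : z ∈ LSet n a m) {s : ℝ}
    (hs : s ∈ unitInterval) : 1 ≤ ∑ k, (shrinkNeg (a k) s (z k) ^ a k).re :=
  (sum_re_pow_eq_one hz).ge.trans
    (Finset.sum_le_sum fun _ _ => re_pow_le_re_shrinkNeg_pow hs)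

/-- The part of the real Lagrangian on which all the summands `z j ^ a j` are nonnegative. -/
def nonnegLSet (n : ℕ) (a m : Fin (n + 1) → ℕ) : Set (Fin (n + 1) → ℂ) :=
  {z | z ∈ LSet n a m ∧ ∀ j, 0 ≤ (z j ^ a j).re}

/-- The deformation of the real Lagrangian onto its nonnegative part. -/
def deformLSet (a : Fin (n + 1) → ℕ) (s : ℝ) (z : Fin (n + 1) → ℂ) : Fin (n + 1) → ℂ :=
  weightedNormalize a fun k => shrinkNeg (a k) s (z k)

lemma deformLSet_mem (ha : ∀ j, 0 < a j) {s : ℝ} (hs : s ∈ unitInterval)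
    {z : Fin (n + 1) → ℂ} (hz : z ∈ LSet n a m) : deformLSet a s z ∈ LSet n a m :=
  weightedNormalize_mem ha (fun j => refl1_shrinkNeg s (hz.2 j))
    (one_pos.trans_le (one_le_sum_re_shrinkNeg_pow hz hs))

lemma deformLSet_one_mem (ha : ∀ j, 0 < a j) {z : Fin (n + 1) → ℂ} (hz : z ∈ LSet n a m) :
    deformLSet a 1 z ∈ nonnegLSet n a m := by
  refine ⟨deformLSet_mem ha unitInterval.one_mem hz, fun j => ?_⟩
  have hpos := one_pos.trans_le (one_le_sum_re_shrinkNeg_pow hz unitInterval.one_mem)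
  rw [deformLSet, weightedNormalize_pow ha hpos, Complex.re_ofReal_mul]
  exact mul_nonneg (inv_nonneg.mpr hpos.le) (re_shrinkNeg_one_pow_nonneg (ha j))

lemma deformLSet_zero {z : Fin (n + 1) → ℂ} (hz : z ∈ LSet n a m) : deformLSet a 0 z = z := by
  simpa [deformLSet] using weightedNormalize_of_mem hz

lemma deformLSet_of_mem_nonneg {z : Fin (n + 1) → ℂ} (hz : z ∈ nonnegLSet n a m) (s : ℝ) :
    deformLSet a s z = z := by
  simpa [deformLSet, shrinkNeg_of_nonneg s (hz.2 _)] using weightedNormalize_of_mem hz.1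

lemma continuous_deformLSet (ha : ∀ j, 0 < a j) :
    Continuous fun p : unitInterval × LSet n a m => deformLSet a p.1 p.2 := by
  have hcoord (k : Fin (n + 1)) :
      Continuous fun p : unitInterval × LSet n a m => (p.2 : Fin (n + 1) → ℂ) k :=
    (continuous_apply k).comp (continuous_subtype_val.comp continuous_snd)
  have hshrink (k : Fin (n + 1)) : Continuous fun p : unitInterval × LSet n a m =>
      shrinkNeg (a k) p.1 ((p.2 : Fin (n + 1) → ℂ) k) := by
    refine Continuous.if_le (hcoord k) (by fun_prop) continuous_const (by fun_prop) fun p hp => ?_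
    rw [eq_zero_of_re_pow_eq_zero (ha k) (p.2.2.2 k) hp.symm, mul_zero]
  have hsum : Continuous fun p : unitInterval × LSet n a m =>
      ∑ k, (shrinkNeg (a k) p.1 ((p.2 : Fin (n + 1) → ℂ) k) ^ a k).re := by fun_prop
  have hpos (p : unitInterval × LSet n a m) :
      0 < ∑ k, (shrinkNeg (a k) p.1 ((p.2 : Fin (n + 1) → ℂ) k) ^ a k).re :=
    one_pos.trans_le (one_le_sum_re_shrinkNeg_pow p.2.2 p.1.2)
  refine continuous_pi fun j => (Complex.continuous_ofReal.comp ?_).mul (hshrink j)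
  exact (hsum.rpow_const fun p => Or.inl (hpos p).ne').inv₀
    fun p => (Real.rpow_pos_of_pos (hpos p) _).ne'

/-- The real Lagrangian deformation retracts onto its nonnegative part. -/
def homotopyEquivNonnegLSet (ha : ∀ j, 0 < a j) :
    ContinuousMap.HomotopyEquiv (LSet n a m) (nonnegLSet n a m) where
  toFun := ⟨fun z => ⟨deformLSet a 1 z, deformLSet_one_mem ha z.2⟩,
    ((continuous_deformLSet ha).comp (Continuous.prodMk_right (1 : unitInterval))).subtype_mk _⟩
  invFun := ⟨fun z => ⟨z, z.2.1⟩, by fun_prop⟩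
  left_inv := ContinuousMap.Homotopic.symm
    ⟨{ toFun := fun p => ⟨deformLSet a p.1 p.2, deformLSet_mem ha p.1.2 p.2.2⟩
       continuous_toFun := (continuous_deformLSet ha).subtype_mk _
       map_zero_left := fun z => Subtype.ext (deformLSet_zero z.2)
       map_one_left := fun _ => rfl }⟩
  right_inv := by
    convert ContinuousMap.Homotopic.refl _
    ext1 z
    exact Subtype.ext (deformLSet_of_mem_nonneg z.2 1).symm

end Retraction

section Join

instance {ι : Type} [Fintype ι] (X : ι → Type) [∀ i, TopologicalSpace (X i)]
    [∀ i, CompactSpace (X i)] : CompactSpace (SpaceJoin X) := by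
  have hcl : IsClosed {p : (∀ i, X i) × (ι → ℝ) |
      (∀ i, p.2 i ∈ Set.Icc (0 : ℝ) 1) ∧ ∑ i, p.2 i = 1} := by
    simp only [Set.ofPred_and, Set.ofPred_forall]
    refine (isClosed_iInter fun i => ?_).inter (isClosed_eq (by fun_prop) (by fun_prop))
    exact isClosed_Icc.preimage (f := fun p : (∀ i, X i) × (ι → ℝ) => p.2 i) (by fun_prop)
  have hc : IsCompact {p : (∀ i, X i) × (ι → ℝ) |
      (∀ i, p.2 i ∈ Set.Icc (0 : ℝ) 1) ∧ ∑ i, p.2 i = 1} := by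
    refine IsCompact.of_isClosed_subset
      (isCompact_univ.prod (isCompact_univ_pi fun _ => isCompact_Icc)) hcl
      fun p hp => ⟨Set.mem_univ _, fun i _ => hp.1 i⟩
  have : CompactSpace (JoinCarrier X) := isCompact_iff_compactSpace.mp hc
  exact inferInstanceAs (CompactSpace (Quot (joinRel X)))

variable {n : ℕ} (a m : Fin (n + 1) → ℕ)

/-- The nonempty zero-dimensional loci `L_{m_j}`. -/
abbrev nonemptyL1 (j : {j : Fin (n + 1) // (L1 (a j) (m j)).Nonempty}) : Type :=
  L1 (a j.1) (m j.1)

/-- The point of `ℂ^{n+1}` with coordinates `t_j ^ (1 / a_j) * x_j`. -/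
def joinCoord (p : JoinCarrier (nonemptyL1 a m)) (j : Fin (n + 1)) : ℂ :=
  if h : (L1 (a j) (m j)).Nonempty then
    ((p.1.2 ⟨j, h⟩ ^ (a j : ℝ)⁻¹ : ℝ) : ℂ) * (p.1.1 ⟨j, h⟩ : ℂ) else 0

variable {a m}

lemma joinCoord_of_nonempty (p : JoinCarrier (nonemptyL1 a m))
    (i : {j : Fin (n + 1) // (L1 (a j) (m j)).Nonempty}) :
    joinCoord a m p i = ((p.1.2 i ^ (a i : ℝ)⁻¹ : ℝ) : ℂ) * (p.1.1 i : ℂ) := dif_pos i.2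

lemma joinCoord_of_not_nonempty (p : JoinCarrier (nonemptyL1 a m)) {j : Fin (n + 1)}
    (h : ¬ (L1 (a j) (m j)).Nonempty) : joinCoord a m p j = 0 := dif_neg h

lemma joinCoord_pow (ha : ∀ j, 0 < a j) (p : JoinCarrier (nonemptyL1 a m))
    (i : {j : Fin (n + 1) // (L1 (a j) (m j)).Nonempty}) :
    joinCoord a m p i ^ a i = (p.1.2 i : ℂ) := by
  rw [joinCoord_of_nonempty, mul_pow, ofReal_rpow_inv_natCast_pow (p.2.1 i).1 (ha i),
    (p.1.1 i).2.1, mul_one]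

lemma sum_eq_sum_subtype {M : Type*} [AddCommMonoid M] {f : Fin (n + 1) → M}
    (P : Fin (n + 1) → Prop) (hf : ∀ j, ¬ P j → f j = 0) : ∑ j, f j = ∑ i : {j // P j}, f i := by
  rw [← Fintype.sum_subtype_add_sum_subtype P f,
    Fintype.sum_eq_zero _ fun i : {j // ¬ P j} => hf i i.2, add_zero]

lemma joinCoord_mem (ha : ∀ j, 0 < a j) (p : JoinCarrier (nonemptyL1 a m)) :
    joinCoord a m p ∈ nonnegLSet n a m := by
  refine ⟨⟨?_, fun j => ?_⟩, fun j => ?_⟩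
  · rw [sum_eq_sum_subtype (fun j => (L1 (a j) (m j)).Nonempty) fun j hj => by
        rw [joinCoord_of_not_nonempty p hj, zero_pow (ha j).ne']]
    rw [Finset.sum_congr rfl fun i _ => joinCoord_pow ha p i, ← Complex.ofReal_sum, p.2.2,
      Complex.ofReal_one]
  · by_cases h : (L1 (a j) (m j)).Nonempty
    · rw [joinCoord_of_nonempty p ⟨j, h⟩]
      exact refl1_ofReal_mul _ (p.1.1 ⟨j, h⟩).2.2
    · simp [joinCoord_of_not_nonempty p h, refl1]
  · by_cases h : (L1 (a j) (m j)).Nonempty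
    · rw [joinCoord_pow ha p ⟨j, h⟩, Complex.ofReal_re]
      exact (p.2.1 _).1
    · simp [joinCoord_of_not_nonempty p h, (ha j).ne']

lemma continuous_joinCoord : Continuous (joinCoord a m) := by
  have hval : Continuous fun p : JoinCarrier (nonemptyL1 a m) => p.1 := continuous_subtype_val
  refine continuous_pi fun j => ?_
  by_cases h : (L1 (a j) (m j)).Nonempty
  · simp only [joinCoord, h, dite_true]
    have hx : Continuous fun p : JoinCarrier (nonemptyL1 a m) => p.1.1 ⟨j, h⟩ :=
      (continuous_apply _).comp (continuous_fst.comp hval)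
    have ht : Continuous fun p : JoinCarrier (nonemptyL1 a m) => p.1.2 ⟨j, h⟩ :=
      (continuous_apply _).comp (continuous_snd.comp hval)
    exact (Complex.continuous_ofReal.comp
      (ht.rpow_const fun _ => Or.inr (by positivity))).mul (continuous_subtype_val.comp hx)
  · simp only [joinCoord, h, dite_false]
    exact continuous_const

lemma joinCoord_eq_iff (ha : ∀ j, 0 < a j) (p q : JoinCarrier (nonemptyL1 a m)) :
    joinCoord a m p = joinCoord a m q ↔ joinRel _ p q := by
  constructor
  · intro h
    have ht : p.1.2 = q.1.2 := by
      funext i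
      have := joinCoord_pow ha p i
      rw [h, joinCoord_pow ha q i] at this
      exact_mod_cast this.symm
    refine ⟨ht, fun i hi => ?_⟩
    have hx := congrFun h i
    rw [joinCoord_of_nonempty, joinCoord_of_nonempty, ← ht] at hx
    refine Subtype.ext (mul_left_cancel₀ ?_ hx)
    exact_mod_cast (Real.rpow_pos_of_pos hi _).ne'
  · rintro ⟨ht, hx⟩
    funext j
    by_cases h : (L1 (a j) (m j)).Nonempty
    · rw [joinCoord_of_nonempty p ⟨j, h⟩, joinCoord_of_nonempty q ⟨j, h⟩, ← ht]
      rcases (p.2.1 ⟨j, h⟩).1.eq_or_lt with h0 | h0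
      · have : ((a j : ℝ))⁻¹ ≠ 0 := inv_ne_zero (by exact_mod_cast (ha j).ne')
        rw [← h0, Real.zero_rpow this, Complex.ofReal_zero, zero_mul, zero_mul]
      · rw [hx _ h0]
    · rw [joinCoord_of_not_nonempty p h, joinCoord_of_not_nonempty q h]

lemma exists_joinCoord_eq (ha : ∀ j, 0 < a j) {z : Fin (n + 1) → ℂ}
    (hz : z ∈ nonnegLSet n a m) : ∃ p, joinCoord a m p = z := by
  have hzero (j : Fin (n + 1)) (hj : ¬ (L1 (a j) (m j)).Nonempty) : z j = 0 := by
    refine eq_zero_of_re_pow_eq_zero (ha j) (hz.1.2 j) (le_antisymm ?_ (hz.2 j))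
    by_contra! hpos
    exact hj ⟨_, inv_rpow_mul_mem_L1 (ha j) (hz.1.2 j) hpos⟩
  have hsum : ∑ i : {j // (L1 (a j) (m j)).Nonempty}, (z i ^ a i).re = 1 := by
    rw [← sum_re_pow_eq_one hz.1]
    refine (sum_eq_sum_subtype (f := fun j => (z j ^ a j).re) _ fun j hj => ?_).symm
    simp [hzero j hj, (ha j).ne']
  have hle (i : {j // (L1 (a j) (m j)).Nonempty}) : (z i ^ a i).re ≤ 1 :=
    hsum ▸ Finset.single_le_sum (f := fun i : {j // (L1 (a j) (m j)).Nonempty} =>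
      (z i ^ a i).re) (fun i _ => hz.2 i) (Finset.mem_univ i)
  let x : ∀ i, nonemptyL1 a m i := fun i =>
    if h : 0 < (z i ^ a i).re then ⟨_, inv_rpow_mul_mem_L1 (ha i) (hz.1.2 i) h⟩
    else ⟨i.2.some, i.2.some_mem⟩
  let p : JoinCarrier (nonemptyL1 a m) :=
    ⟨(x, fun i => (z i ^ a i).re), fun i => ⟨hz.2 i, hle i⟩, hsum⟩
  refine ⟨p, ?_⟩
  funext j
  by_cases h : (L1 (a j) (m j)).Nonempty
  · rw [joinCoord_of_nonempty p ⟨j, h⟩]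
    by_cases hpos : 0 < (z j ^ a j).re
    · have h0 : (((z j ^ a j).re ^ (a j : ℝ)⁻¹ : ℝ) : ℂ) ≠ 0 := by
        exact_mod_cast (Real.rpow_pos_of_pos hpos _).ne'
      simp only [p, x, hpos, dite_true, Complex.ofReal_inv]
      exact mul_inv_cancel_left₀ h0 _
    · have h0 : (z j ^ a j).re = 0 := le_antisymm (not_lt.mp hpos) (hz.2 j)
      have : ((a j : ℝ))⁻¹ ≠ 0 := inv_ne_zero (by exact_mod_cast (ha j).ne')
      simp only [p, h0, Real.zero_rpow this, Complex.ofReal_zero, zero_mul]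
      exact (eq_zero_of_re_pow_eq_zero (ha j) (hz.1.2 j) h0).symm
  · rw [joinCoord_of_not_nonempty p h, hzero j h]

/-- The join of the nonempty `L_{m_j}` is the nonnegative part of the real Lagrangian. -/
def joinHomeomorphNonnegLSet (ha : ∀ j, 0 < a j) :
    SpaceJoin (nonemptyL1 a m) ≃ₜ nonnegLSet n a m :=
  have (i : {j // (L1 (a j) (m j)).Nonempty}) : CompactSpace (nonemptyL1 a m i) :=
    isCompact_iff_compactSpace.mp (finite_L1 (ha i)).isCompact
  let f : SpaceJoin (nonemptyL1 a m) → nonnegLSet n a m :=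
    Quot.lift (fun p => ⟨joinCoord a m p, joinCoord_mem ha p⟩)
      fun p q h => Subtype.ext ((joinCoord_eq_iff ha p q).mpr h)
  have hf : Continuous f := continuous_quot_lift _ (continuous_joinCoord.subtype_mk _)
  have hbij : Function.Bijective f := by
    refine ⟨?_, fun z => ?_⟩
    · rintro ⟨p⟩ ⟨q⟩ h
      exact Quot.sound ((joinCoord_eq_iff ha p q).mp (congrArg Subtype.val h))
    · obtain ⟨p, hp⟩ := exists_joinCoord_eq ha z.2
      exact ⟨Quot.mk _ p, Subtype.ext hp⟩
  hf.homeoOfEquivCompactToT2 (f := Equiv.ofBijective f hbij)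

end Join

/-- **Theorem** (Topology of real Lagrangians in Brieskorn Milnor fibers).
The real Lagrangian `L_𝐦` is homotopy equivalent to the join of the `L_{m_j}`,
where (following the convention `X * ∅ = ∅ * X = X`) the join is taken over those
indices `j` for which `L_{m_j}` is nonempty. -/
theorem real_lagrangian_homotopy_equiv_join (n : ℕ) (a m : Fin (n + 1) → ℕ)
    (ha : ∀ j, 0 < a j) (hm : ∀ j, m j < a j) :
    Nonempty (ContinuousMap.HomotopyEquiv (↥(LSet n a m))
      (SpaceJoin (fun j : {j : Fin (n + 1) // (L1 (a j) (m j)).Nonempty} =>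
        ↥(L1 (a j.1) (m j.1))))) := by
  exact ⟨(homotopyEquivNonnegLSet ha).trans (joinHomeomorphNonnegLSet ha).symm.toHomotopyEquiv⟩
end
end

section
/- Let n ≥ 0, let a = (a_0,…,a_n) be positive integers and m = (m_0,…,m_n) integers with 0 ≤ m_j ≤ a_j−1. If the set L_m = {z ∈ ℂ^{n+1} : z_0^{a_0}+⋯+z_n^{a_n} = 1 and e^{2πi m_j/a_j}·conj(z_j) = z_j for all j} is nonempty, then (with its subspace topology) it is either contractible, or homotopy equivalent to the k-dimensional unit sphere S^k ⊆ ℝ^{k+1} for some 0 ≤ k ≤ n. -/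
noncomputable section

lemma strictMono_mul_abs_pow (c : ℕ) : StrictMono fun x : ℝ => x * |x| ^ c := by
  intro x y hxy
  rcases le_or_gt 0 x with hx | hx
  · have hy : 0 ≤ y := hx.trans hxy.le
    simp only [abs_of_nonneg hx, abs_of_nonneg hy, ← pow_succ']
    exact pow_lt_pow_left₀ hxy hx (Nat.succ_ne_zero c)
  · rcases le_or_gt 0 y with hy | hy
    · exact (mul_neg_of_neg_of_pos hx (pow_pos (abs_pos.2 hx.ne) c)).trans_le (by positivity)
    · have h := pow_lt_pow_left₀ (neg_lt_neg hxy) (neg_nonneg.2 hy.le) (Nat.succ_ne_zero c)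
      simp only [abs_of_neg hx, abs_of_neg hy]
      rw [pow_succ', pow_succ'] at h
      linarith

/-- The homeomorphism `x ↦ x |x|^c` of the real line. -/
def mulAbsPowHomeomorph (c : ℕ) : ℝ ≃ₜ ℝ :=
  ((strictMono_mul_abs_pow c).orderIsoOfSurjective _ <| by
    have hcont : Continuous fun x : ℝ => x * |x| ^ c := by fun_prop
    refine hcont.surjective ?_ ?_
    · refine Filter.tendsto_atTop_mono' _ ?_ Filter.tendsto_id
      filter_upwards [Filter.eventually_ge_atTop 1] with x hx
      have : 1 ≤ |x| ^ c := one_le_pow₀ (hx.trans (le_abs_self x))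
      simp only [id]
      nlinarith
    · refine Filter.tendsto_atBot_mono' _ ?_ Filter.tendsto_id
      filter_upwards [Filter.eventually_le_atBot (-1)] with x hx
      have : 1 ≤ |x| ^ c := one_le_pow₀ ((le_neg.1 hx).trans (neg_le_abs x))
      simp only [id]
      nlinarith).toHomeomorph

lemma mulAbsPowHomeomorph_apply (c : ℕ) (x : ℝ) : mulAbsPowHomeomorph c x = x * |x| ^ c := rfl

/-- The power map `x ↦ ± x ^ a` on the real line is, in a suitable global coordinate,
one of `s`, `s ^ 2`, `-s ^ 2`. -/
lemma exists_homeomorph_signed_pow (a m : ℕ) (ha : 0 < a) :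
    ∃ e : ℝ ≃ₜ ℝ, (∀ x, (-1) ^ m * x ^ a = e x) ∨ (∀ x, (-1) ^ m * x ^ a = e x ^ 2) ∨
      (∀ x, (-1) ^ m * x ^ a = -e x ^ 2) := by
  rcases Nat.even_or_odd' a with ⟨b, rfl | rfl⟩
  · obtain ⟨c, rfl⟩ : ∃ c, b = c + 1 := ⟨b - 1, by omega⟩
    have key (x : ℝ) : x ^ (2 * (c + 1)) = mulAbsPowHomeomorph c x ^ 2 := by
      rw [mulAbsPowHomeomorph_apply, mul_pow, ← pow_mul, mul_comm c 2, pow_mul |x|, sq_abs]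
      ring
    refine ⟨mulAbsPowHomeomorph c, Or.inr ?_⟩
    rcases neg_one_pow_eq_or ℝ m with h | h
    · exact Or.inl fun x => by rw [h, key, one_mul]
    · exact Or.inr fun x => by rw [h, key, neg_one_mul]
  · have key (x : ℝ) : x ^ (2 * b + 1) = mulAbsPowHomeomorph (2 * b) x := by
      rw [mulAbsPowHomeomorph_apply, pow_mul |x|, sq_abs]
      ring
    rcases neg_one_pow_eq_or ℝ m with h | h
    · exact ⟨mulAbsPowHomeomorph (2 * b), Or.inl fun x => by rw [h, key, one_mul]⟩
    · refine ⟨(mulAbsPowHomeomorph (2 * b)).trans (Homeomorph.neg ℝ), Or.inl fun x => ?_⟩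
      rw [h, key, neg_one_mul]
      rfl

/-- A parametrization of the fixed line of `refl1 a m` which puts the map `z ↦ z ^ a` on this line
in normal form. -/
lemma exists_fixedLine_param (a m : ℕ) (ha : 0 < a) :
    ∃ (φ : ℝ → ℂ) (ψ : ℂ → ℝ) (q : ℝ → ℝ), Continuous φ ∧ Continuous ψ ∧
      (∀ s, refl1 a m (φ s) = φ s) ∧ (∀ s, ψ (φ s) = s) ∧
      (∀ z, refl1 a m z = z → φ (ψ z) = z) ∧ (∀ s, φ s ^ a = q s) ∧
      (q = (fun s => s) ∨ q = (fun s => s ^ 2) ∨ q = fun s => -s ^ 2) := by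
  obtain ⟨e, he⟩ := exists_homeomorph_signed_pow a m ha
  obtain ⟨q, hqe, hq⟩ : ∃ q : ℝ → ℝ, (∀ x, (-1) ^ m * x ^ a = q (e x)) ∧
      (q = (fun s => s) ∨ q = (fun s => s ^ 2) ∨ q = fun s => -s ^ 2) := by
    rcases he with he | he | he
    · exact ⟨_, he, Or.inl rfl⟩
    · exact ⟨fun s => s ^ 2, he, Or.inr (Or.inl rfl)⟩
    · exact ⟨fun s => -s ^ 2, he, Or.inr (Or.inr rfl)⟩
  have ha' : (a : ℂ) ≠ 0 := by exact_mod_cast ha.ne'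
  set ω : ℂ := Complex.exp (((Real.pi * m / a : ℝ) : ℂ) * Complex.I) with hω
  have hω_sq : Complex.exp (2 * (Real.pi : ℂ) * Complex.I * (m : ℂ) / (a : ℂ)) = ω * ω := by
    rw [hω, ← Complex.exp_add]
    congr 1
    push_cast
    ring
  have hω_pow : ω ^ a = (-1) ^ m := by
    rw [hω, ← Complex.exp_nat_mul, ← Complex.exp_pi_mul_I, ← Complex.exp_nat_mul]
    congr 1
    push_cast
    field_simp
  have hω_conj : ω * (starRingEnd ℂ) ω = 1 := by
    rw [Complex.mul_conj, Complex.normSq_eq_norm_sq, hω, Complex.norm_exp_ofReal_mul_I]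
    simp
  refine ⟨fun s => ω * (e.symm s : ℝ), fun z => e ((starRingEnd ℂ) ω * z).re, q, ?_, ?_,
    fun s => ?_, fun s => ?_, fun z hz => ?_, fun s => ?_, hq⟩
  · exact continuous_const.mul (Complex.continuous_ofReal.comp e.symm.continuous)
  · exact e.continuous.comp (Complex.continuous_re.comp (continuous_const.mul continuous_id))
  · rw [refl1, hω_sq, map_mul, Complex.conj_ofReal]
    linear_combination ω * (e.symm s : ℝ) * hω_conj
  · dsimp only
    rw [← mul_assoc, mul_comm _ ω, hω_conj, one_mul, Complex.ofReal_re, e.apply_symm_apply]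
  · rw [refl1, hω_sq] at hz
    have hreal : (starRingEnd ℂ) ((starRingEnd ℂ) ω * z) = (starRingEnd ℂ) ω * z := by
      rw [map_mul, Complex.conj_conj]
      linear_combination (starRingEnd ℂ) ω * hz - ω * (starRingEnd ℂ) z * hω_conj
    dsimp only
    rw [e.symm_apply_apply, Complex.conj_eq_iff_re.1 hreal]
    linear_combination z * hω_conj
  · have h := hqe (e.symm s)
    rw [e.apply_symm_apply] at h
    rw [← h, mul_pow, hω_pow]
    push_cast
    rfl

/-- A retract of a contractible space is contractible. -/
lemma contractibleSpace_of_retract {X Y : Type*} [TopologicalSpace X] [TopologicalSpace Y]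
    [ContractibleSpace Y] (i : C(X, Y)) (r : C(Y, X)) (h : ∀ x, r (i x) = x) :
    ContractibleSpace X := by
  rw [contractible_iff_id_nullhomotopic]
  have : ContinuousMap.id X = (r.comp (ContinuousMap.id Y)).comp i := by
    ext x
    exact (h x).symm
  rw [this]
  exact ((id_nullhomotopic Y).comp_right r).comp_left i

/-- The graph-like hypersurface `∑ q i (s i) = 1`, with some `q j` the identity, is contractible. -/
lemma contractibleSpace_sum_eq_one {ι : Type*} [Fintype ι] (q : ι → ℝ → ℝ)
    (hq : ∀ i, Continuous (q i)) (j : ι) (hj : q j = fun s => s) :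
    ContractibleSpace {s : ι → ℝ | ∑ i, q i (s i) = 1} := by
  classical
  let r (s : ι → ℝ) : ι → ℝ :=
    Function.update s j (1 - ∑ i ∈ Finset.univ.erase j, q i (s i))
  have hr (s : ι → ℝ) : ∑ i, q i (r s i) = 1 := by
    rw [← Finset.add_sum_erase _ _ (Finset.mem_univ j), Finset.sum_congr rfl
      (g := fun i => q i (s i)) fun i hi => by simp [r, Finset.ne_of_mem_erase hi]]
    simp [r, hj]
  have hrc : Continuous r := by
    refine continuous_id.update j (continuous_const.sub (continuous_finsetSum _ fun i _ => ?_))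
    exact (hq i).comp (continuous_apply i)
  refine contractibleSpace_of_retract (Y := ι → ℝ) ⟨Subtype.val, continuous_subtype_val⟩
    ⟨fun s => ⟨r s, hr s⟩, hrc.subtype_mk _⟩ fun s => Subtype.ext ?_
  have hs : ∑ i, q i (s.1 i) = 1 := s.2
  rw [← Finset.add_sum_erase _ _ (Finset.mem_univ j), hj] at hs
  change Function.update s.1 j (1 - ∑ i ∈ Finset.univ.erase j, q i (s.1 i)) = s.1
  rw [← eq_sub_of_add_eq hs, Function.update_eq_self]

/-- The quadric `∑_{i ∈ P} s i ^ 2 = 1 + ∑_{i ∉ P} s i ^ 2` is homotopy equivalent to the unit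
sphere in `ℝ^P`. -/
lemma nonempty_homotopyEquiv_quadric_sphere {ι : Type*} [Fintype ι] [DecidableEq ι] (P : Finset ι)
    {d : ℕ} (hd : P.card = d) :
    Nonempty (ContinuousMap.HomotopyEquiv
      {s : ι → ℝ | ∑ i ∈ P, s i ^ 2 = 1 + ∑ i ∈ Pᶜ, s i ^ 2}
      (Metric.sphere (0 : EuclideanSpace ℝ (Fin d)) 1)) := by
  let e : P ≃ Fin d := P.equivFinOfCardEq hd
  have sphere_iff (u : EuclideanSpace ℝ (Fin d)) :
      u ∈ Metric.sphere (0 : EuclideanSpace ℝ (Fin d)) 1 ↔ ∑ i, u i ^ 2 = 1 := by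
    rw [mem_sphere_zero_iff_norm, ← sq_eq_sq₀ (norm_nonneg u) zero_le_one,
      EuclideanSpace.real_norm_sq_eq, one_pow]
  have sum_eq (f : ι → ℝ) : ∑ i : Fin d, f (e.symm i) = ∑ i ∈ P, f i := by
    rw [e.symm.sum_comp fun i : P => f i, Finset.sum_coe_sort]
  let ν (s : ι → ℝ) : ℝ := ∑ i ∈ Pᶜ, s i ^ 2
  have hν (s : ι → ℝ) : 0 ≤ ν s := Finset.sum_nonneg fun i _ => sq_nonneg _
  have hνc : Continuous ν := by fun_prop
  have hpos (s : ι → ℝ) : 0 < √(1 + ν s) := Real.sqrt_pos.2 (by linarith [hν s])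
  let f (s : ι → ℝ) : EuclideanSpace ℝ (Fin d) :=
    WithLp.toLp 2 fun i => s (e.symm i) / √(1 + ν s)
  let g (u : EuclideanSpace ℝ (Fin d)) : ι → ℝ := fun i => if h : i ∈ P then u (e ⟨i, h⟩) else 0
  let H (p : ℝ × (ι → ℝ)) : ι → ℝ := fun i =>
    if i ∈ P then p.2 i * (√(1 + p.1 ^ 2 * ν p.2) / √(1 + ν p.2)) else p.1 * p.2 i
  have hfc : Continuous f := by
    refine (PiLp.continuous_toLp 2 _).comp (continuous_pi fun i => ?_)
    exact (continuous_apply _).div (by fun_prop) fun s => (hpos s).ne'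
  have hgc : Continuous g := by
    refine continuous_pi fun i => ?_
    by_cases h : i ∈ P
    · simp only [g, h, dite_true]
      fun_prop
    · simp only [g, h, dite_false]
      fun_prop
  have hHc : Continuous H := by
    refine continuous_pi fun i => ?_
    by_cases h : i ∈ P
    · simp only [H, h, if_true]
      refine ((continuous_apply i).comp continuous_snd).mul
        (Continuous.div (by fun_prop) (by fun_prop) fun p => (hpos p.2).ne')
    · simp only [H, h, if_false]
      fun_prop
  have hg_of_mem (u : EuclideanSpace ℝ (Fin d)) (i : Fin d) : g u (e.symm i) = u i := by
    simp [g]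
  have hνg (u : EuclideanSpace ℝ (Fin d)) : ν (g u) = 0 := by
    refine Finset.sum_eq_zero fun i hi => ?_
    simp [g, Finset.mem_compl.1 hi]
  have hf (s : ι → ℝ) (hs : ∑ i ∈ P, s i ^ 2 = 1 + ν s) :
      f s ∈ Metric.sphere (0 : EuclideanSpace ℝ (Fin d)) 1 := by
    rw [sphere_iff]
    simp only [f, div_pow]
    rw [sum_eq fun i => s i ^ 2 / √(1 + ν s) ^ 2, ← Finset.sum_div,
      Real.sq_sqrt (by linarith [hν s]), hs, div_self (by linarith [hν s])]
  have hg (u : EuclideanSpace ℝ (Fin d))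
      (hu : u ∈ Metric.sphere (0 : EuclideanSpace ℝ (Fin d)) 1) :
      ∑ i ∈ P, g u i ^ 2 = 1 + ν (g u) := by
    rw [sphere_iff] at hu
    rw [hνg, add_zero, ← sum_eq fun i => g u i ^ 2]
    simpa only [hg_of_mem] using hu
  have hH (τ : ℝ) (s : ι → ℝ) (hs : ∑ i ∈ P, s i ^ 2 = 1 + ν s) :
      ∑ i ∈ P, H (τ, s) i ^ 2 = 1 + ν (H (τ, s)) := by
    have h₁ : ∑ i ∈ P, H (τ, s) i ^ 2 = 1 + τ ^ 2 * ν s := by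
      rw [Finset.sum_congr rfl (g := fun i => s i ^ 2 * ((1 + τ ^ 2 * ν s) / (1 + ν s)))
        fun i hi => ?_, ← Finset.sum_mul, hs, mul_div_cancel₀ _ (by linarith [hν s])]
      have : 0 ≤ τ ^ 2 * ν s := mul_nonneg (sq_nonneg _) (hν s)
      simp only [H, hi, if_true, mul_pow, div_pow]
      rw [Real.sq_sqrt (by linarith), Real.sq_sqrt (by linarith [hν s])]
    have h₂ : ν (H (τ, s)) = τ ^ 2 * ν s := by
      simp only [ν, Finset.mul_sum]
      refine Finset.sum_congr rfl fun i hi => ?_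
      simp only [H, Finset.mem_compl.1 hi, if_false, mul_pow]
    rw [h₁, h₂]
  refine ⟨⟨⟨fun s => ⟨f s.1, hf s.1 s.2⟩, ?_⟩, ⟨fun u => ⟨g u.1, hg u.1 u.2⟩, ?_⟩, ⟨⟨⟨fun p =>
    ⟨H (p.1, p.2.1), hH _ _ p.2.2⟩, ?_⟩, fun s => Subtype.ext ?_, fun s => Subtype.ext ?_⟩⟩, ?_⟩⟩
  · exact (hfc.comp continuous_subtype_val).subtype_mk _
  · exact (hgc.comp continuous_subtype_val).subtype_mk _
  · exact (hHc.comp (by fun_prop)).subtype_mk _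
  · funext i
    by_cases h : i ∈ P
    · simp [H, g, f, h, div_eq_mul_inv]
    · simp [H, g, h]
  · funext i
    by_cases h : i ∈ P
    · simp [H, h, div_self (hpos s.1).ne']
    · simp [H, h]
  · convert ContinuousMap.Homotopic.refl _
    ext u i
    simp only [ContinuousMap.comp_apply, ContinuousMap.coe_mk, ContinuousMap.id_apply, f]
    rw [hg_of_mem, hνg]
    simp

/-- **Theorem**: if the real Lagrangian `L_𝐦` is nonempty, it is either contractible or
homotopy equivalent to the `k`-dimensional unit sphere `S^k ⊆ ℝ^{k+1}` for some `0 ≤ k ≤ n`. -/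
theorem real_lagrangian_contractible_or_sphere (n : ℕ) (a m : Fin (n + 1) → ℕ)
    (ha : ∀ j, 0 < a j) (hm : ∀ j, m j < a j) (hne : (LSet n a m).Nonempty) :
    ContractibleSpace ↥(LSet n a m) ∨
      ∃ k ≤ n, Nonempty (ContinuousMap.HomotopyEquiv (↥(LSet n a m))
        (Metric.sphere (0 : EuclideanSpace ℝ (Fin (k + 1))) 1)) := by
  classical
  choose φ ψ q hφ hψ hfix hψφ hφψ hpow hq using fun j => exists_fixedLine_param (a j) (m j) (ha j)
  have hsum (s : Fin (n + 1) → ℝ) :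
      ∑ j, φ j (s j) ^ a j = 1 ↔ ∑ j, q j (s j) = 1 := by
    simp only [hpow]
    exact_mod_cast Iff.rfl
  let E : LSet n a m ≃ₜ {s : Fin (n + 1) → ℝ | ∑ j, q j (s j) = 1} :=
    { toFun := fun z => ⟨fun j => ψ j (z.1 j), (hsum _).1 <| by
        simpa only [hφψ _ _ (z.2.2 _)] using z.2.1⟩
      invFun := fun s => ⟨fun j => φ j (s.1 j), (hsum _).2 s.2, fun j => hfix j _⟩
      left_inv := fun z => Subtype.ext <| funext fun j => hφψ j _ (z.2.2 j)
      right_inv := fun s => Subtype.ext <| funext fun j => hψφ j _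
      continuous_toFun := Continuous.subtype_mk (continuous_pi fun j =>
        (hψ j).comp ((continuous_apply j).comp continuous_subtype_val)) _
      continuous_invFun := Continuous.subtype_mk (continuous_pi fun j =>
        (hφ j).comp ((continuous_apply j).comp continuous_subtype_val)) _ }
  by_cases hlin : ∃ j, q j = fun s => s
  · obtain ⟨j, hj⟩ := hlin
    have := contractibleSpace_sum_eq_one q
      (fun i => by rcases hq i with h | h | h <;> rw [h] <;> fun_prop) j hj
    exact Or.inl E.contractibleSpace
  · push Not at hlin
    let P : Finset (Fin (n + 1)) := Finset.univ.filter fun j => q j = fun s => s ^ 2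
    have hP (j) (hj : j ∈ P) (s : ℝ) : q j s = s ^ 2 := by
      rw [(Finset.mem_filter.1 hj).2]
    have hPc (j) (hj : j ∈ Pᶜ) (s : ℝ) : q j s = -s ^ 2 := by
      rcases hq j with h | h | h
      · exact absurd h (hlin j)
      · exact absurd (Finset.mem_filter.2 ⟨Finset.mem_univ j, h⟩) (Finset.mem_compl.1 hj)
      · rw [h]
    have hset : {s : Fin (n + 1) → ℝ | ∑ j, q j (s j) = 1} =
        {s | ∑ j ∈ P, s j ^ 2 = 1 + ∑ j ∈ Pᶜ, s j ^ 2} := by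
      ext s
      rw [Set.mem_ofPred_eq, Set.mem_ofPred_eq, ← Finset.sum_add_sum_compl P,
        Finset.sum_congr rfl fun j hj => hP j hj (s j),
        Finset.sum_congr rfl fun j hj => hPc j hj (s j), Finset.sum_neg_distrib, ← sub_eq_add_neg,
        sub_eq_iff_eq_add]
    have hPne : P.Nonempty := by
      obtain ⟨z, hz⟩ := hne
      have h : _ = _ := hset.subset (E ⟨z, hz⟩).2
      by_contra hP
      rw [Finset.not_nonempty_iff_eq_empty] at hP
      rw [hP, Finset.sum_empty] at h
      linarith [Finset.sum_nonneg fun j (_ : j ∈ (∅ : Finset (Fin (n + 1)))ᶜ) =>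
        sq_nonneg ((E ⟨z, hz⟩).1 j)]
    have hcard : P.card = P.card - 1 + 1 := (Nat.sub_add_cancel hPne.card_pos).symm
    have hle : P.card ≤ n + 1 := by simpa using P.card_le_univ
    obtain ⟨F⟩ := nonempty_homotopyEquiv_quadric_sphere P hcard
    exact Or.inr ⟨P.card - 1, by omega,
      ⟨(E.trans (Homeomorph.setCongr hset)).toHomotopyEquiv.trans F⟩⟩
end
end

section
/- Let n ≥ 0, let a = (a_0,…,a_n) be positive integers and suppose a_j is odd for some j. Then for every tuple m = (m_0,…,m_n) of integers with 0 ≤ m_j ≤ a_j−1, the set L_m = {z ∈ ℂ^{n+1} : z_0^{a_0}+⋯+z_n^{a_n} = 1 and e^{2πi m_j/a_j}·conj(z_j) = z_j for all j}, with its subspace topology, is a contractible (in particular nonempty) topological space. -/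
noncomputable section

/-- A retract of a contractible space is contractible. -/
theorem ContractibleSpace.of_leftInverse {X Y : Type*} [TopologicalSpace X] [TopologicalSpace Y]
    [ContractibleSpace X] (r : C(X, Y)) (i : C(Y, X)) (h : Function.LeftInverse r i) :
    ContractibleSpace Y := by
  rw [contractible_iff_id_nullhomotopic]
  have hid : r.comp ((ContinuousMap.id X).comp i) = ContinuousMap.id Y :=
    ContinuousMap.ext h
  rw [← hid]
  exact ((id_nullhomotopic X).comp_left i).comp_right r

/-- Real odd powers have a continuous two-sided inverse. -/
theorem Odd.exists_continuous_root {k : ℕ} (hk : Odd k) :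
    ∃ f : ℝ → ℝ, Continuous f ∧ (∀ t, f t ^ k = t) ∧ ∀ t, f (t ^ k) = t := by
  have hmono : StrictMono fun t : ℝ => t ^ k := hk.strictMono_pow
  have htop : Filter.Tendsto (fun t : ℝ => t ^ k) Filter.atTop Filter.atTop :=
    Filter.tendsto_pow_atTop hk.pos.ne'
  have hbot : Filter.Tendsto (fun t : ℝ => t ^ k) Filter.atBot Filter.atBot := by
    have h := Filter.tendsto_neg_atTop_atBot.comp (htop.comp Filter.tendsto_neg_atBot_atTop)
    simpa [Function.comp_def, hk.neg_pow] using h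
  have hsurj : Function.Surjective fun t : ℝ => t ^ k :=
    (continuous_pow k).surjective htop hbot
  let e := hmono.orderIsoOfSurjective _ hsurj
  exact ⟨e.symm, e.symm.continuous, e.apply_symm_apply, e.symm_apply_apply⟩

/-- The unit complex number `e^{πim/a}` spanning the real line fixed by `refl1 a m`. -/
def fixedDirection (a m : ℕ) : ℂ :=
  Complex.exp (((Real.pi * m / a : ℝ) : ℂ) * Complex.I)

theorem fixedDirection_mul_conj (a m : ℕ) :
    fixedDirection a m * (starRingEnd ℂ) (fixedDirection a m) = 1 := by
  rw [Complex.mul_conj, Complex.normSq_eq_norm_sq, fixedDirection, Complex.norm_exp_ofReal_mul_I]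
  simp

theorem refl1_eq (a m : ℕ) (z : ℂ) :
    refl1 a m z = fixedDirection a m ^ 2 * (starRingEnd ℂ) z := by
  rw [refl1, fixedDirection, ← Complex.exp_nat_mul]
  congr 2
  push_cast
  ring

theorem fixedDirection_pow {a : ℕ} (ha : 0 < a) (m : ℕ) :
    fixedDirection a m ^ a = (-1) ^ m := by
  have ha' : (a : ℂ) ≠ 0 := by exact_mod_cast ha.ne'
  rw [fixedDirection, ← Complex.exp_nat_mul, ← Complex.exp_pi_mul_I, ← Complex.exp_nat_mul]
  congr 1
  push_cast
  field_simp

theorem refl1_fixedDirection_mul (a m : ℕ) (r : ℝ) :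
    refl1 a m (fixedDirection a m * r) = fixedDirection a m * r := by
  rw [refl1_eq, map_mul, Complex.conj_ofReal]
  linear_combination (fixedDirection a m * r) * fixedDirection_mul_conj a m

theorem eq_fixedDirection_mul_re {a m : ℕ} {z : ℂ} (hz : refl1 a m z = z) :
    z = fixedDirection a m * (((starRingEnd ℂ) (fixedDirection a m) * z).re : ℂ) := by
  have hω := fixedDirection_mul_conj a m
  have hreal : (starRingEnd ℂ) ((starRingEnd ℂ) (fixedDirection a m) * z) =
      (starRingEnd ℂ) (fixedDirection a m) * z := by
    rw [refl1_eq] at hz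
    rw [map_mul, Complex.conj_conj]
    linear_combination (starRingEnd ℂ) (fixedDirection a m) * hz -
      fixedDirection a m * (starRingEnd ℂ) z * hω
  rw [Complex.conj_eq_iff_re.mp hreal]
  linear_combination -z * hω

/-- In the coordinates `z_j = e^{πim_j/a_j} r_j`, the set `LSet n a m` is a real hypersurface. -/
theorem fixedDirection_mul_mem_LSet_iff {n : ℕ} {a m : Fin (n + 1) → ℕ} (ha : ∀ j, 0 < a j)
    (r : Fin (n + 1) → ℝ) :
    (fun j => fixedDirection (a j) (m j) * (r j : ℂ)) ∈ LSet n a m ↔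
      ∑ j, (-1) ^ m j * r j ^ a j = 1 := by
  simp only [LSet, Set.mem_ofPred_eq, refl1_fixedDirection_mul, implies_true, and_true, mul_pow,
    fixedDirection_pow (ha _)]
  exact_mod_cast Iff.rfl

/-- **Theorem**: if some exponent `a_j` is odd, then for every admissible `𝐦` the real
Lagrangian `L_𝐦` is a contractible (in particular nonempty) topological space. -/
theorem real_lagrangian_contractible_of_odd_exponent (n : ℕ) (a : Fin (n + 1) → ℕ)
    (ha : ∀ j, 0 < a j) (hodd : ∃ j, Odd (a j))
    (m : Fin (n + 1) → ℕ) (hm : ∀ j, m j < a j) :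
    (LSet n a m).Nonempty ∧ ContractibleSpace ↥(LSet n a m) := by
  obtain ⟨j, hj⟩ := hodd
  obtain ⟨root, hroot, root_pow, pow_root⟩ := hj.exists_continuous_root
  let solve (x : Fin (n + 1) → ℝ) : Fin (n + 1) → ℝ := Function.update x j
    (root ((-1) ^ m j * (1 - ∑ i ∈ Finset.univ.erase j, (-1) ^ m i * x i ^ a i)))
  have sign_sq : ((-1 : ℝ) ^ m j) * (-1) ^ m j = 1 := by
    rw [← mul_pow]
    simp
  have solve_spec (x : Fin (n + 1) → ℝ) : ∑ i, (-1) ^ m i * solve x i ^ a i = 1 := by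
    rw [← Finset.add_sum_erase _ _ (Finset.mem_univ j)]
    have hsum : ∑ i ∈ Finset.univ.erase j, (-1 : ℝ) ^ m i * solve x i ^ a i =
        ∑ i ∈ Finset.univ.erase j, (-1) ^ m i * x i ^ a i :=
      Finset.sum_congr rfl fun i hi => by
        simp only [solve, Function.update_of_ne (Finset.ne_of_mem_erase hi)]
    rw [hsum]
    simp only [solve, Function.update_self, root_pow]
    rw [← mul_assoc, sign_sq]
    ring
  have solve_eq (x : Fin (n + 1) → ℝ) (hx : ∑ i, (-1) ^ m i * x i ^ a i = 1) :
      solve x = x := by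
    rw [← Finset.add_sum_erase _ _ (Finset.mem_univ j)] at hx
    rw [Function.update_eq_self_iff, ← eq_sub_of_add_eq hx, ← mul_assoc, sign_sq, one_mul,
      pow_root]
  have solve_cont : Continuous solve :=
    continuous_id.update j (hroot.comp (by fun_prop))
  let r : C(Fin (n + 1) → ℝ, LSet n a m) :=
    ⟨fun x => ⟨fun i => fixedDirection (a i) (m i) * (solve x i : ℂ),
      (fixedDirection_mul_mem_LSet_iff ha _).mpr (solve_spec x)⟩, by
      refine Continuous.subtype_mk (continuous_pi fun i => ?_) _
      have := (continuous_apply i).comp solve_cont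
      exact continuous_const.mul (Complex.continuous_ofReal.comp this)⟩
  let coord : C(LSet n a m, Fin (n + 1) → ℝ) :=
    ⟨fun z i => ((starRingEnd ℂ) (fixedDirection (a i) (m i)) * z.1 i).re, continuous_pi fun i =>
      Complex.continuous_re.comp
        (continuous_const.mul ((continuous_apply i).comp continuous_subtype_val))⟩
  refine ⟨⟨_, (r 0).2⟩, ContractibleSpace.of_leftInverse r coord fun z => Subtype.ext ?_⟩
  have hz : (fun i => fixedDirection (a i) (m i) * (coord z i : ℂ)) = z.1 :=
    funext fun i => (eq_fixedDirection_mul_re (z.2.2 i)).symm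
  have hsolve : solve (coord z) = coord z :=
    solve_eq _ ((fixedDirection_mul_mem_LSet_iff ha _).mp (hz.symm ▸ z.2))
  change (fun i => fixedDirection (a i) (m i) * (solve (coord z) i : ℂ)) = z.1
  rw [hsolve, hz]
end
end

section
/- Let k ≥ 1 and consider a = (k+1, 2, 2, 2) and m = (0, 1, 1, 1), so that L_m = {z ∈ ℂ^{4} : z_0^{k+1} + z_1^2 + z_2^2 + z_3^2 = 1, conj(z_0) = z_0, and −conj(z_j) = z_j for j = 1,2,3}. Then, with its subspace topology: if k is even, L_m is contractible; if k is odd, L_m is homotopy equivalent to the 0-sphere S^0, i.e. to a discrete two-point space. -/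
noncomputable section

/-- The real Lagrangian `L_𝐦 ⊆ V(k+1, 2, 2, 2)` for `𝐦 = (0, 1, 1, 1)`: the fixed point
set of `(z_0, z_1, z_2, z_3) ↦ (conj z_0, −conj z_1, −conj z_2, −conj z_3)` in the
`A_k`-type Milnor fiber. -/
def LAk (k : ℕ) : Set (Fin 4 → ℂ) :=
  {z | z 0 ^ (k + 1) + z 1 ^ 2 + z 2 ^ 2 + z 3 ^ 2 = 1 ∧
    (starRingEnd ℂ) (z 0) = z 0 ∧
    -((starRingEnd ℂ) (z 1)) = z 1 ∧
    -((starRingEnd ℂ) (z 2)) = z 2 ∧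
    -((starRingEnd ℂ) (z 3)) = z 3}

theorem mem_LAk_iff {k : ℕ} {z : Fin 4 → ℂ} :
    z ∈ LAk k ↔
      (z 0).re ^ (k + 1) = 1 + ((z 1).im ^ 2 + (z 2).im ^ 2 + (z 3).im ^ 2) ∧
        (z 0).im = 0 ∧ (z 1).re = 0 ∧ (z 2).re = 0 ∧ (z 3).re = 0 := by
  have real_iff (w : ℂ) : (starRingEnd ℂ) w = w ↔ w.im = 0 := Complex.conj_eq_iff_im
  have imag_iff (w : ℂ) : -(starRingEnd ℂ) w = w ↔ w.re = 0 := by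
    rw [Complex.ext_iff]
    simp only [Complex.neg_re, Complex.conj_re, Complex.neg_im, Complex.conj_im, neg_neg,
      and_true]
    constructor <;> intro h <;> linarith
  simp only [LAk, Set.mem_ofPred_eq, real_iff, imag_iff]
  refine and_congr_left fun ⟨h0, h1, h2, h3⟩ => ?_
  have e0 : z 0 = ((z 0).re : ℂ) := Complex.ext (by simp) (by simp [h0])
  have sq_eq (w : ℂ) (hw : w.re = 0) : w ^ 2 = ((-w.im ^ 2 : ℝ) : ℂ) := by
    apply Complex.ext <;> simp [pow_two, hw]
  rw [e0, sq_eq _ h1, sq_eq _ h2, sq_eq _ h3]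
  norm_cast
  constructor <;> intro h <;> linarith

/-- The squared norm of the imaginary coordinates `z 1`, `z 2`, `z 3`. -/
def imNormSq (z : Fin 4 → ℂ) : ℝ := (z 1).im ^ 2 + (z 2).im ^ 2 + (z 3).im ^ 2

theorem imNormSq_nonneg (z : Fin 4 → ℂ) : 0 ≤ imNormSq z := by
  unfold imNormSq; positivity

theorem continuous_imNormSq : Continuous imNormSq := by
  unfold imNormSq; fun_prop

/-- Scale the last three coordinates by `t` and rescale the first one so as to stay in
`LAk k`. -/
def LAkScale (k : ℕ) (t : ℝ) (z : Fin 4 → ℂ) : Fin 4 → ℂ :=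
  ![((z 0).re * ((1 + t ^ 2 * imNormSq z) / (1 + imNormSq z)) ^ (((k + 1 : ℕ) : ℝ)⁻¹) : ℝ),
    t * z 1, t * z 2, t * z 3]

theorem LAkScale_mem {k : ℕ} (t : ℝ) {z : Fin 4 → ℂ} (hz : z ∈ LAk k) :
    LAkScale k t z ∈ LAk k := by
  obtain ⟨h, h0, h1, h2, h3⟩ := mem_LAk_iff.1 hz
  have hS := imNormSq_nonneg z
  change _ = 1 + imNormSq z at h
  have hr : 0 ≤ (1 + t ^ 2 * imNormSq z) / (1 + imNormSq z) := by positivity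
  refine mem_LAk_iff.2 ⟨?_, ?_, ?_, ?_, ?_⟩
  · simp only [LAkScale, Matrix.cons_val, Complex.ofReal_re, Complex.im_ofReal_mul]
    rw [mul_pow, Real.rpow_inv_natCast_pow hr k.succ_ne_zero, h,
      mul_div_cancel₀ _ (by positivity)]
    simp only [imNormSq]; ring
  all_goals simp [LAkScale, h1, h2, h3]

theorem LAkScale_one {k : ℕ} {z : Fin 4 → ℂ} (hz : z ∈ LAk k) : LAkScale k 1 z = z := by
  obtain ⟨-, h0, -⟩ := mem_LAk_iff.1 hz
  have hS := imNormSq_nonneg z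
  have e0 : ((z 0).re : ℂ) = z 0 := Complex.ext (by simp) (by simp [h0])
  have hr : (1 + (1 : ℝ) ^ 2 * imNormSq z) / (1 + imNormSq z) = 1 := by
    rw [one_pow, one_mul, div_self (by positivity)]
  ext i
  fin_cases i <;> simp [LAkScale, hr, e0, -one_pow]

theorem continuous_LAkScale (k : ℕ) :
    Continuous fun p : ℝ × (Fin 4 → ℂ) => LAkScale k p.1 p.2 := by
  have hS := continuous_imNormSq
  have hr : Continuous fun p : ℝ × (Fin 4 → ℂ) =>
      ((1 + p.1 ^ 2 * imNormSq p.2) / (1 + imNormSq p.2)) ^ (((k + 1 : ℕ) : ℝ)⁻¹) := by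
    refine Continuous.rpow_const (Continuous.div (by fun_prop) (by fun_prop) fun p => ?_)
      fun p => Or.inr (by positivity)
    have := imNormSq_nonneg p.2
    positivity
  refine continuous_pi fun i => ?_
  fin_cases i
  · exact Complex.continuous_ofReal.comp
      ((Complex.continuous_re.comp ((continuous_apply 0).comp continuous_snd)).mul hr)
  all_goals simp only [LAkScale]; fun_prop

/-- The point of `LAk k` with real coordinate `x` and vanishing imaginary coordinates. -/
def LAkPoint (k : ℕ) (x : ℝ) (hx : x ^ (k + 1) = 1) : LAk k :=
  ⟨![(x : ℂ), 0, 0, 0], mem_LAk_iff.2 (by simp [hx])⟩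

/-- The real coordinate of the image of `z` under `LAkScale k 0`. -/
def LAkSign (k : ℕ) (z : LAk k) : ℝ := (LAkScale k 0 z.1 0).re

theorem LAkScale_zero_apply (k : ℕ) (z : LAk k) :
    LAkScale k 0 z.1 = ![(LAkSign k z : ℂ), 0, 0, 0] := by
  ext i
  fin_cases i <;> simp [LAkScale, LAkSign]

theorem LAkSign_pow (k : ℕ) (z : LAk k) : LAkSign k z ^ (k + 1) = 1 := by
  have h := (mem_LAk_iff.1 (LAkScale_mem 0 z.2)).1
  rw [LAkScale_zero_apply] at h
  simpa using h

/-- Scaling deforms the identity of `LAk k` to any map which agrees with the scaling at `0`. -/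
def LAkHomotopy (k : ℕ) (f : C(LAk k, LAk k)) (hf : ∀ z, LAkScale k 0 z.1 = (f z).1) :
    f.Homotopy (ContinuousMap.id (LAk k)) where
  toFun p := ⟨LAkScale k p.1 p.2, LAkScale_mem _ p.2.2⟩
  continuous_toFun := by
    refine Continuous.subtype_mk ?_ _
    exact (continuous_LAkScale k).comp
      (f := fun p : unitInterval × LAk k => ((p.1 : ℝ), (p.2 : Fin 4 → ℂ))) (by fun_prop)
  map_zero_left z := Subtype.ext (by simpa using hf z)
  map_one_left z := Subtype.ext (by simpa using LAkScale_one z.2)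

theorem LAk_contractibleSpace {k : ℕ} (hk : Even k) : ContractibleSpace (LAk k) := by
  refine (contractible_iff_id_nullhomotopic _).2
    ⟨LAkPoint k 1 (one_pow _), ⟨(LAkHomotopy k (.const _ _) fun z => ?_).symm⟩⟩
  have hs : LAkSign k z = 1 := by
    have h := LAkSign_pow k z
    exact hk.add_one.strictMono_pow.injective (by simpa using h)
  rw [LAkScale_zero_apply, hs]
  rfl

theorem continuous_LAkSign (k : ℕ) : Continuous (LAkSign k) := by
  refine Complex.continuous_re.comp ((continuous_apply 0).comp ?_)
  exact (continuous_LAkScale k).comp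
    (f := fun z : LAk k => ((0 : ℝ), (z : Fin 4 → ℂ))) (by fun_prop)

theorem LAk_homotopyEquiv_bool {k : ℕ} (hk : Odd k) :
    Nonempty (ContinuousMap.HomotopyEquiv (LAk k) Bool) := by
  have hs (z : LAk k) : LAkSign k z = 1 ∨ LAkSign k z = -1 := by
    have h := (pow_eq_one_iff_of_ne_zero k.succ_ne_zero).1 (LAkSign_pow k z)
    exact h.imp id And.left
  let f : C(LAk k, Bool) := ⟨fun z => decide (0 < LAkSign k z), by
    refine continuous_bool_rng true |>.2 ⟨?_, ?_⟩
    · have : (fun z => decide (0 < LAkSign k z)) ⁻¹' {true} = LAkSign k ⁻¹' Set.Ici 1 := by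
        ext z
        rcases hs z with h | h <;> simp [h]
        norm_num
      rw [this]
      exact isClosed_Ici.preimage (continuous_LAkSign k)
    · have : (fun z => decide (0 < LAkSign k z)) ⁻¹' {true} = LAkSign k ⁻¹' Set.Ioi 0 := by
        ext z
        simp
      rw [this]
      exact isOpen_Ioi.preimage (continuous_LAkSign k)⟩
  let g : C(Bool, LAk k) :=
    ⟨fun b => LAkPoint k (if b then 1 else -1) (by
      cases b <;> simp [hk.add_one.neg_one_pow]), continuous_of_discreteTopology⟩
  refine ⟨⟨f, g, ⟨LAkHomotopy k _ fun z => ?_⟩, ?_⟩⟩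
  · rw [LAkScale_zero_apply]
    rcases hs z with h | h <;> simp [f, g, LAkPoint, h]
    norm_num
  · have : f.comp g = ContinuousMap.id Bool := by
      ext b
      cases b <;> simp [f, g, LAkPoint, LAkSign, LAkScale, imNormSq]
    rw [this]

/-- **Example**: in the `A_k`-type Milnor fiber `V(k+1,2,2,2)`, the real Lagrangian
`L_{(0,1,1,1)}` is contractible if `k` is even, and homotopy equivalent to the discrete
two-point space `S^0` (realized as `Bool`) if `k` is odd. -/
theorem Ak_real_lagrangian_homotopy_type (k : ℕ) (hk : 1 ≤ k) :
    (Even k → ContractibleSpace ↥(LAk k)) ∧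
    (Odd k → Nonempty (ContinuousMap.HomotopyEquiv (↥(LAk k)) Bool)) := by
  exact ⟨LAk_contractibleSpace, LAk_homotopyEquiv_bool⟩
end
end
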